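/- Let S be a quasi completely regular semiring. Then S is quasi-orthodox if and only if S satisfies the identity 0_a+0_b+0_{(a+b)} = 0_{(a+b)} for all a, b ∈ S. -/

import Mathlib

/-- A "semiring" in the sense of the paper: both reducts are semigroups
(no commutativity, no identities) and multiplication distributes over
addition on both sides. -/
class PSemiring (S : Type*) extends AddSemigroup S, Semigroup S where
  left_distrib : ∀ a b c : S, a * (b + c) = a * b + a * c
  right_distrib : ∀ a b c : S, (a + b) * c = a * c + b * c

namespace PSemiring

variable {S : Type*} [PSemiring S]

/-- `nmul n a` is the `(n+1)`-fold sum `a + ⋯ + a`; thus the positive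
multiple `m·a` of the paper is `nmul (m-1) a`. -/
def nmul : ℕ → S → S
  | 0, a => a
  | n + 1, a => nmul n a + a

/-- `a` is additively regular. -/
def AddRegular (a : S) : Prop := ∃ x, a + x + a = a

/-- `a` is a completely regular element. -/
def CompletelyRegularElem (a : S) : Prop :=
  ∃ x, a = a + x + a ∧ a + x = x + a ∧ a * (a + x) = a + x

/-- `S` is a quasi completely regular semiring. -/
def QuasiCompletelyRegular (S : Type*) [PSemiring S] : Prop :=
  ∀ a : S, ∃ n : ℕ, CompletelyRegularElem (nmul n a)

/-- `S` is a completely regular semiring. -/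
def CompletelyRegularSemiring (S : Type*) [PSemiring S] : Prop :=
  ∀ a : S, CompletelyRegularElem a

/-- `e` is an additive idempotent (i.e. `e ∈ E⁺(S)`). -/
def AddIdem (e : S) : Prop := e + e = e

/-- `V⁺(a)`, the set of additive inverses of `a`. -/
def Vplus (a : S) : Set S := {x | a + x + a = a ∧ x + a + x = x}

/-- `{a} ∪ (S + a)`. -/
def lset (a : S) : Set S := insert a {x | ∃ s, x = s + a}

/-- `{a} ∪ (a + S)`. -/
def rset (a : S) : Set S := insert a {x | ∃ s, x = a + s}

/-- `{a} ∪ (S + a) ∪ (a + S) ∪ (S + a + S)`. -/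
def jset (a : S) : Set S :=
  insert a ({x | ∃ s, x = s + a} ∪ {x | ∃ s, x = a + s} ∪ {x | ∃ s t, x = s + a + t})

/-- Green's relation `L⁺` on the additive reduct. -/
def GreenL (a b : S) : Prop := lset a = lset b

/-- Green's relation `R⁺` on the additive reduct. -/
def GreenR (a b : S) : Prop := rset a = rset b

/-- Green's relation `J⁺` on the additive reduct. -/
def GreenJ (a b : S) : Prop := jset a = jset b

/-- `n` is the least index such that the `(n+1)`-fold sum of `a` is additively
regular, i.e. `(n+1)·a` is the least additively regular positive multiple. -/
def LeastReg (a : S) (n : ℕ) : Prop :=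
  AddRegular (nmul n a) ∧ ∀ m < n, ¬ AddRegular (nmul m a)

/-- The relation `L*⁺`. -/
def LStar (a b : S) : Prop :=
  ∃ p q, LeastReg a p ∧ LeastReg b q ∧ GreenL (nmul p a) (nmul q b)

/-- The relation `R*⁺`. -/
def RStar (a b : S) : Prop :=
  ∃ p q, LeastReg a p ∧ LeastReg b q ∧ GreenR (nmul p a) (nmul q b)

/-- The relation `J*⁺`. -/
def JStar (a b : S) : Prop :=
  ∃ p q, LeastReg a p ∧ LeastReg b q ∧ GreenJ (nmul p a) (nmul q b)

/-- `H*⁺ = L*⁺ ∩ R*⁺`. -/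
def HStar (a b : S) : Prop := LStar a b ∧ RStar a b

/-- `D*⁺ = L*⁺ ∘ R*⁺` (relational composition). -/
def DStar (a b : S) : Prop := ∃ c, LStar a c ∧ RStar c b

/-- `z = 0_a`: `z = na + x` where `n` is the least positive integer with `na`
completely regular and `x` is the (unique) element with `na = na+x+na`,
`x = x+na+x` and `na+x = x+na`. -/
def IsZeroOf (a z : S) : Prop :=
  ∃ n x, (CompletelyRegularElem (nmul n a) ∧
      ∀ m < n, ¬ CompletelyRegularElem (nmul m a)) ∧
    nmul n a = nmul n a + x + nmul n a ∧ x = x + nmul n a + x ∧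
    nmul n a + x = x + nmul n a ∧ z = nmul n a + x

/-- The relation `𝒴`, relative to a choice `z` of the map `a ↦ 0_a`. -/
def Yrel (z : S → S) (a b : S) : Prop := Vplus (a + z a) = Vplus (b + z b)

/-- A (semiring) congruence. -/
structure IsCong (r : S → S → Prop) : Prop where
  refl : ∀ a, r a a
  symm : ∀ {a b}, r a b → r b a
  trans : ∀ {a b c}, r a b → r b c → r a c
  addl : ∀ (c : S) {a b}, r a b → r (c + a) (c + b)
  addr : ∀ (c : S) {a b}, r a b → r (a + c) (b + c)
  mull : ∀ (c : S) {a b}, r a b → r (c * a) (c * b)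
  mulr : ∀ (c : S) {a b}, r a b → r (a * c) (b * c)

/-- `r` is a b-lattice congruence: `S/r` is a b-lattice. -/
def IsBLatticeCong (r : S → S → Prop) : Prop :=
  IsCong r ∧ (∀ a : S, r (a * a) a) ∧ (∀ a : S, r (a + a) a) ∧
    ∀ a b : S, r (a + b) (b + a)

/-- `r` is the least b-lattice congruence. -/
def IsLeastBLatticeCong (r : S → S → Prop) : Prop :=
  IsBLatticeCong r ∧ ∀ r', IsBLatticeCong r' → ∀ a b, r a b → r' a b

/-- `r` is a skew-ring congruence: `S/r` is a semiring whose additive reduct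
is a group (expressed by solvability of both translation equations). -/
def IsSkewRingCong (r : S → S → Prop) : Prop :=
  IsCong r ∧ ∀ a b : S, (∃ x, r (a + x) b) ∧ ∃ y, r (y + a) b

/-- `r` is the least skew-ring congruence. -/
def IsLeastSkewRingCong (r : S → S → Prop) : Prop :=
  IsSkewRingCong r ∧ ∀ r', IsSkewRingCong r' → ∀ a b, r a b → r' a b

/-- `η` is a b-lattice-of-skew-rings congruence: `S/η` admits a congruence `ξ`
(given here as a congruence on `S` containing `η`) such that `(S/η)/ξ` is a
b-lattice and every `ξ`-class of `S/η` is a subsemiring whose additive reduct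
is a group. -/
def IsBLSRCong (η : S → S → Prop) : Prop :=
  IsCong η ∧ ∃ ξ : S → S → Prop, IsCong ξ ∧ (∀ a b, η a b → ξ a b) ∧
    (∀ a : S, ξ (a * a) a) ∧ (∀ a : S, ξ (a + a) a) ∧
    (∀ a b : S, ξ (a + b) (b + a)) ∧
    (∀ a b, ξ a b → ξ (a + b) a ∧ ξ (a * b) a) ∧
    ∀ a b, ξ a b → (∃ x, ξ x a ∧ η (a + x) b) ∧ ∃ y, ξ y a ∧ η (y + a) b

/-- `ν` is the least b-lattice-of-skew-rings congruence. -/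
def IsLeastBLSRCong (ν : S → S → Prop) : Prop :=
  IsBLSRCong ν ∧ ∀ η, IsBLSRCong η → ∀ a b, ν a b → η a b

/-- `r` is a completely regular semiring congruence: `S/r` is completely
regular. -/
def IsCRCong (r : S → S → Prop) : Prop :=
  IsCong r ∧ ∀ a : S, ∃ x, r a (a + x + a) ∧ r (a + x) (x + a) ∧
    r (a * (a + x)) (a + x)

/-- `ρ` is the least completely regular semiring congruence. -/
def IsLeastCRCong (r : S → S → Prop) : Prop :=
  IsCRCong r ∧ ∀ r', IsCRCong r' → ∀ a b, r a b → r' a b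

/-- `S` is quasi-orthodox. -/
def QuasiOrthodox (S : Type*) [PSemiring S] : Prop :=
  ∀ e f : S, AddIdem e → AddIdem f →
    ∃ n : ℕ, nmul n (e + f) = nmul (n + 1) (e + f)

/-- `S` is a completely Archimedean semiring. -/
def CompletelyArchimedean (S : Type*) [PSemiring S] : Prop :=
  QuasiCompletelyRegular S ∧ ∀ a b : S, JStar a b

/-- `r` is the least congruence containing the relation `τ`. -/
def IsLeastCongContaining (τ r : S → S → Prop) : Prop :=
  IsCong r ∧ (∀ a b, τ a b → r a b) ∧
    ∀ r', IsCong r' → (∀ a b, τ a b → r' a b) → ∀ a b, r a b → r' a b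

/-- `r` is a generalized additive idempotent pure congruence (purity part). -/
def GenAddIdemPure (r : S → S → Prop) : Prop :=
  ∀ a e : S, AddIdem e → r a e → ∃ n : ℕ, nmul n a = nmul (n + 1) a

/-- `τ^e`: `a = x + c + y`, `b = x + d + y` for some `(c,d) ∈ τ`, where each of
`x`, `y` may also be absent (i.e. `x, y ∈ S⁰`). -/
def relE (τ : S → S → Prop) (a b : S) : Prop :=
  ∃ c d, τ c d ∧ ((a = c ∧ b = d) ∨ (∃ x, a = x + c ∧ b = x + d) ∨
    (∃ y, a = c + y ∧ b = d + y) ∨ ∃ x y, a = x + c + y ∧ b = x + d + y)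

/-- `τ^♮`: the transitive closure of `(τ ∪ τ⁻¹ ∪ ε)^e`. -/
def natClosure (τ : S → S → Prop) : S → S → Prop :=
  Relation.TransGen (relE (fun a b => τ a b ∨ τ b a ∨ a = b))

end PSemiring

namespace PSemiring

variable {S : Type*} [PSemiring S]

theorem add_nmul_comm (n : ℕ) (a : S) : a + nmul n a = nmul n a + a := by
  induction n with
  | zero => rfl
  | succ n ih => simp only [nmul]; rw [← add_assoc, ih]

theorem nmul_add_index (m n : ℕ) (a : S) : nmul m a + nmul n a = nmul (m + n + 1) a := by
  induction n with
  | zero => rfl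
  | succ n ih => simp only [nmul]; rw [← add_assoc, ih]; rfl

theorem nmul_nmul (m n : ℕ) (a : S) : nmul m (nmul n a) = nmul (m * n + m + n) a := by
  induction m with
  | zero => simp [nmul]
  | succ m ih =>
    rw [nmul, ih, nmul_add_index]
    congr 1
    ring

theorem nmul_nmul_comm (m n : ℕ) (a : S) : nmul m (nmul n a) = nmul n (nmul m a) := by
  rw [nmul_nmul, nmul_nmul]
  congr 1
  ring

theorem AddIdem.nmul_eq {e : S} (he : AddIdem e) (n : ℕ) : nmul n e = e := by
  induction n with
  | zero => rfl
  | succ n ih => rw [nmul, ih, he]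

theorem AddIdem.mul_left {e : S} (he : AddIdem e) (a : S) : AddIdem (a * e) := by
  rw [AddIdem, ← left_distrib, he]

theorem AddIdem.mul_right {e : S} (he : AddIdem e) (a : S) : AddIdem (e * a) := by
  rw [AddIdem, ← right_distrib, he]

theorem nmul_mul (n : ℕ) (a b : S) : nmul n a * b = nmul n (a * b) := by
  induction n with
  | zero => rfl
  | succ n ih => rw [nmul, nmul, right_distrib, ih]

theorem mul_nmul (n : ℕ) (a b : S) : a * nmul n b = nmul n (a * b) := by
  induction n with
  | zero => rfl
  | succ n ih => rw [nmul, nmul, left_distrib, ih]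

theorem nmul_add_of_add_eq {a b : S} (h : a + b = b) (n : ℕ) : nmul n a + b = b := by
  induction n with
  | zero => exact h
  | succ n ih => rw [nmul, add_assoc, h, ih]

theorem add_nmul_of_add_eq {a b : S} (h : a + b = b) (n : ℕ) : a + nmul n b = nmul n b := by
  induction n with
  | zero => exact h
  | succ n ih => rw [nmul, ← add_assoc, ih]

theorem nmul_add_of_eq_add {a b : S} (h : a + b = a) (n : ℕ) : nmul n a + b = nmul n a := by
  cases n with
  | zero => exact h
  | succ n => rw [nmul, add_assoc, h]

namespace IsZeroOf

variable {a z : S}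

theorem addIdem (h : IsZeroOf a z) : AddIdem z := by
  obtain ⟨n, x, -, h1, -, -, rfl⟩ := h
  rw [AddIdem, ← add_assoc, ← h1]

theorem nmul_mul_self (h : IsZeroOf a z) : ∃ n, nmul n a * z = z := by
  obtain ⟨n, x, ⟨⟨y, hy1, hy2, hy3⟩, -⟩, h1, -, h3, rfl⟩ := h
  have key : nmul n a + x = nmul n a + y := by
    calc nmul n a + x = x + (nmul n a + y + nmul n a) := by rw [h3, ← hy1]
      _ = x + (nmul n a + (nmul n a + y)) := by rw [hy2, ← add_assoc (nmul n a), hy2]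
      _ = x + nmul n a + nmul n a + y := by simp only [add_assoc]
      _ = nmul n a + y := by rw [← h3, ← h1]
  exact ⟨n, by rw [key, hy3]⟩

/-- An element acts on additive idempotents from the left as its zero does. -/
theorem mul_idem (h : IsZeroOf a z) {e : S} (he : AddIdem e) : z * e = a * e := by
  obtain ⟨n, x, -, h1, -, h3, rfl⟩ := h
  have hn : nmul n a * e = a * e := by rw [nmul_mul, (he.mul_left a).nmul_eq]
  have h1' := congrArg (· * e) h1
  have h3' := congrArg (· * e) h3
  simp only [right_distrib, hn] at h1' h3' ⊢
  conv_rhs => rw [h1', h3', add_assoc, he.mul_left a, ← h3']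

/-- An element acts on additive idempotents from the right as its zero does. -/
theorem idem_mul (h : IsZeroOf a z) {e : S} (he : AddIdem e) : e * z = e * a := by
  obtain ⟨n, x, -, h1, -, h3, rfl⟩ := h
  have hn : e * nmul n a = e * a := by rw [mul_nmul, (he.mul_right a).nmul_eq]
  have h1' := congrArg (e * ·) h1
  have h3' := congrArg (e * ·) h3
  simp only [left_distrib, hn] at h1' h3' ⊢
  conv_rhs => rw [h1', h3', add_assoc, he.mul_right a, ← h3']

theorem mul_self (h : IsZeroOf a z) : a * z = z := by
  obtain ⟨n, hn⟩ := h.nmul_mul_self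
  rwa [nmul_mul, (h.addIdem.mul_left a).nmul_eq] at hn

theorem self_mul (h : IsZeroOf a z) : z * a = z := by
  rw [← h.idem_mul h.addIdem, h.mul_idem h.addIdem, h.mul_self]

theorem eq_of_addIdem (h : IsZeroOf a z) (ha : AddIdem a) : z = a := by
  obtain ⟨n, x, -, h1, -, h3, rfl⟩ := h
  rw [ha.nmul_eq] at h1 h3 ⊢
  conv_rhs => rw [h1, h3, add_assoc, ha, ← h3]

/-- The zero of a sum of two elements is the zero of the sum of their zeros. -/
theorem eq_of_add {b zb c k : S} (ha : IsZeroOf a z) (hb : IsZeroOf b zb)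
    (hc : IsZeroOf (a + b) c) (hk : IsZeroOf (z + zb) k) : c = k := by
  calc c = (a + b) * c := hc.mul_self.symm
    _ = (z + zb) * c := by
      rw [right_distrib, right_distrib, ha.mul_idem hc.addIdem, hb.mul_idem hc.addIdem]
    _ = k * c := (hk.mul_idem hc.addIdem).symm
    _ = k * (a + b) := hc.idem_mul hk.addIdem
    _ = k * (z + zb) := by
      rw [left_distrib, left_distrib, ha.idem_mul hk.addIdem, hb.idem_mul hk.addIdem]
    _ = k := hk.self_mul

theorem add_self_of_nmul_eq (h : IsZeroOf a z) {n : ℕ} (hn : nmul n a = nmul (n + 1) a) :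
    a + z = z := by
  obtain ⟨N, x, -, h1, -, h3, rfl⟩ := h
  have hAz : nmul N a + (nmul N a + x) = nmul N a := by
    conv_lhs => rw [h3, ← add_assoc, ← h1]
  have hw : ∀ m, ∃ w, nmul m (nmul N a) + w = nmul N a + x := by
    intro m
    induction m with
    | zero => exact ⟨x, rfl⟩
    | succ m ih =>
      obtain ⟨w, hw⟩ := ih
      refine ⟨x + w, ?_⟩
      rw [nmul, add_assoc, ← add_assoc _ x, ← add_assoc, nmul_add_of_eq_add hAz, hw]
  obtain ⟨w, hw⟩ := hw n
  have ha : a + nmul n a = nmul n a := (add_nmul_comm n a).trans hn.symm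
  rw [← hw, ← add_assoc, nmul_nmul_comm, add_nmul_of_add_eq ha]

theorem exists_nmul_eq_of_add_self (h : IsZeroOf a z) (haz : a + z = z) :
    ∃ n, nmul n a = nmul (n + 1) a := by
  obtain ⟨n, x, -, h1, -, h3, rfl⟩ := h
  have hA : nmul n a = nmul n a + x := by
    rw [← nmul_add_of_add_eq haz n]
    conv_rhs => rw [h3, ← add_assoc, ← h1]
  exact ⟨n, by rw [nmul, ← add_nmul_comm, hA, haz]⟩

end IsZeroOf

end PSemiring

open PSemiring

/-- A quasi completely regular semiring `S` is quasi-orthodox iff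
it satisfies the identity `0_a + 0_b + 0_{(a+b)} = 0_{(a+b)}`. -/
theorem quasiOrthodox_iff_zero_identity {S : Type*} [PSemiring S]
    (hS : QuasiCompletelyRegular S) (z : S → S) (hz : ∀ a, IsZeroOf a (z a)) :
    QuasiOrthodox S ↔ ∀ a b : S, z a + z b + z (a + b) = z (a + b) := by
  constructor
  · intro h a b
    obtain ⟨n, hn⟩ := h _ _ (hz a).addIdem (hz b).addIdem
    rw [(hz a).eq_of_add (hz b) (hz (a + b)) (hz (z a + z b))]
    exact (hz (z a + z b)).add_self_of_nmul_eq hn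
  · intro h e f he hf
    have hef := h e f
    rw [(hz e).eq_of_addIdem he, (hz f).eq_of_addIdem hf] at hef
    exact (hz (e + f)).exists_nmul_eq_of_add_self hef
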